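/- Displacement of LGL intervals with increasing order: let N and M be integers with M ≥ N ≥ 2, let k be an integer with 0 ≤ k ≤ ⌊(N−1)/2⌋, and let j be an integer with 0 ≤ j ≤ ⌊(M−1)/2⌋. If ξ_j^M ≤ ξ_k^N, then the corresponding LGL intervals satisfy |Δ_j^M| ≤ |Δ_k^N|. -/

import Mathlib

/-- The Legendre polynomial of degree `N` via the Rodrigues formula. -/
noncomputable def legendrePoly (N : ℕ) : Polynomial ℝ :=
  Polynomial.C (1 / (2 ^ N * N.factorial : ℝ)) *
    Polynomial.derivative^[N] ((Polynomial.X ^ 2 - 1) ^ N)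

/-- The polynomial `(1 - x²)·L_N'(x)` whose zeros are the LGL nodes of order `N`. -/
noncomputable def lglPoly (N : ℕ) : Polynomial ℝ :=
  (1 - Polynomial.X ^ 2) * Polynomial.derivative (legendrePoly N)

/-- `ξ 0 < ξ 1 < ⋯ < ξ N` enumerates the Legendre-Gauss-Lobatto nodes of order `N`
in increasing order. -/
def IsLGLNodes (N : ℕ) (ξ : ℕ → ℝ) : Prop :=
  StrictMonoOn ξ (Set.Iic N) ∧ ξ 0 = -1 ∧ ξ N = 1 ∧
    (∀ k ≤ N, (lglPoly N).eval (ξ k) = 0) ∧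
    (∀ x : ℝ, (lglPoly N).eval x = 0 → ∃ k ≤ N, ξ k = x)


/-- Sturm comparison: under a Wronskian sign condition, the solution `v` of the faster
equation vanishes no later than `u`. -/
theorem sturm_comparison {u u' u'' v v' v'' : ℝ → ℝ} {α β : ℝ} (hαβ : α < β)
    (hu : ∀ x, HasDerivAt u (u' x) x) (hu' : ∀ x, HasDerivAt u' (u'' x) x)
    (hv : ∀ x, HasDerivAt v (v' x) x) (hv' : ∀ x, HasDerivAt v' (v'' x) x)
    (huα : u α = 0) (hvα : v α = 0) (huβ : u β = 0)
    (hupos : ∀ x ∈ Set.Ioo α β, 0 < u x) (hvpos : ∀ x ∈ Set.Ioc α β, 0 < v x)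
    (hW : ∀ x ∈ Set.Ioo α β, 0 ≤ u'' x * v x - u x * v'' x) : False := by
  have hWd : ∀ x, HasDerivAt (fun x => u' x * v x - u x * v' x)
      (u'' x * v x - u x * v'' x) x := fun x =>
    (((hu' x).mul (hv x)).sub ((hu x).mul (hv' x))).congr_deriv (by ring)
  have hWmono : MonotoneOn (fun x => u' x * v x - u x * v' x) (Set.Icc α β) :=
    monotoneOn_of_hasDerivWithinAt_nonneg (convex_Icc _ _)
      (fun x _ => (hWd x).continuousAt.continuousWithinAt)
      (fun x _ => (hWd x).hasDerivWithinAt)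
      (fun x hx => hW x (by simpa using hx))
  have hWnonneg : ∀ x ∈ Set.Icc α β, 0 ≤ u' x * v x - u x * v' x := fun x hx => by
    simpa [huα, hvα] using hWmono (Set.left_mem_Icc.2 hαβ.le) hx hx.1
  obtain ⟨c, hc⟩ := exists_between hαβ
  have hfd : ∀ x ∈ Set.Icc c β, HasDerivAt (fun x => u x / v x)
      ((u' x * v x - u x * v' x) / v x ^ 2) x := fun x hx =>
    (hu x).div (hv x) (hvpos x ⟨hc.1.trans_le hx.1, hx.2⟩).ne'
  have hfmono : MonotoneOn (fun x => u x / v x) (Set.Icc c β) :=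
    monotoneOn_of_hasDerivWithinAt_nonneg (convex_Icc _ _)
      (fun x hx => (hfd x hx).continuousAt.continuousWithinAt)
      (fun x hx => (hfd x (interior_subset hx)).hasDerivWithinAt)
      (fun x hx => div_nonneg
        (hWnonneg x ⟨hc.1.le.trans (interior_subset hx).1, (interior_subset hx).2⟩)
        (sq_nonneg _))
  have h := hfmono (Set.left_mem_Icc.2 hc.2.le) (Set.right_mem_Icc.2 hc.2.le) hc.2.le
  simp only [huβ, zero_div] at h
  exact absurd h (not_le.2 (div_pos (hupos c hc) (hvpos c ⟨hc.1, hc.2.le⟩)))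

/-- Symmetrized Picone comparison on `[-a, a]`: the potential `Q` is compared with `q` only
after averaging over `y` and `-y`. -/
theorem symmetric_picone_comparison {u u' u'' v v' v'' q Q : ℝ → ℝ} {a : ℝ} (ha : 0 < a)
    (hu : ∀ x, HasDerivAt u (u' x) x) (hu' : ∀ x, HasDerivAt u' (u'' x) x)
    (hv : ∀ x, HasDerivAt v (v' x) x) (hv' : ∀ x, HasDerivAt v' (v'' x) x)
    (hu0 : u 0 ≠ 0) (hu'0 : u' 0 = 0) (hua : u a = 0)
    (hvpos : ∀ x ∈ Set.Icc (-a) a, 0 < v x)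
    (hueq : ∀ x ∈ Set.Ioo 0 a, u'' x = -q x * u x)
    (hveq : ∀ x ∈ Set.Ioo (-a) a, v'' x = -Q x * v x)
    (hqQ : ∀ x ∈ Set.Ioo 0 a, 2 * q x ≤ Q x + Q (-x)) : False := by
  have hpos : ∀ x ∈ Set.Icc 0 a, 0 < v x ∧ 0 < v (-x) := fun x hx =>
    ⟨hvpos x ⟨by linarith [hx.1], hx.2⟩, hvpos (-x) ⟨by linarith [hx.2], by linarith [hx.1]⟩⟩
  have hm : ∀ x, HasDerivAt (fun x => v (-x)) (-v' (-x)) x := fun x =>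
    ((hv (-x)).comp x (hasDerivAt_neg x)).congr_deriv (by ring)
  have hm' : ∀ x, HasDerivAt (fun x => v' (-x)) (-v'' (-x)) x := fun x =>
    ((hv' (-x)).comp x (hasDerivAt_neg x)).congr_deriv (by ring)
  set R : ℝ → ℝ := fun x => (v' x / v x - v' (-x) / v (-x)) / 2 with hR
  set Φ : ℝ → ℝ := fun x => u x * u' x - u x ^ 2 * R x with hΦ
  have hRd : ∀ x ∈ Set.Icc 0 a, HasDerivAt R
      (((v'' x * v x - v' x * v' x) / v x ^ 2
        - (-v'' (-x) * v (-x) - v' (-x) * -v' (-x)) / v (-x) ^ 2) / 2) x := fun x hx =>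
    (((hv' x).div (hv x) (hpos x hx).1.ne').sub
      ((hm' x).div (hm x) (hpos x hx).2.ne')).div_const 2
  have hΦd : ∀ x ∈ Set.Icc 0 a, HasDerivAt Φ
      ((u' x * u' x + u x * u'' x) - (2 * u x * u' x * R x + u x ^ 2 *
      (((v'' x * v x - v' x * v' x) / v x ^ 2
        - (-v'' (-x) * v (-x) - v' (-x) * -v' (-x)) / v (-x) ^ 2) / 2))) x := fun x hx =>
    (((hu x).mul (hu' x)).sub (((hu x).pow 2).mul (hRd x hx))).congr_deriv (by simp)
  have hΦmono : MonotoneOn Φ (Set.Icc 0 a) := by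
    refine monotoneOn_of_hasDerivWithinAt_nonneg (convex_Icc _ _)
      (fun x hx => (hΦd x hx).continuousAt.continuousWithinAt)
      (fun x hx => (hΦd x (interior_subset hx)).hasDerivWithinAt) (fun x hx => ?_)
    rw [interior_Icc] at hx
    obtain ⟨h1, h2⟩ := hpos x ⟨hx.1.le, hx.2.le⟩
    rw [hueq x hx, hveq x ⟨by linarith [hx.1], hx.2⟩,
      hveq (-x) ⟨by linarith [hx.2], by linarith [hx.1, hx.2]⟩]
    have e : ((-Q x * v x * v x - v' x * v' x) / v x ^ 2
        - (-(-Q (-x) * v (-x)) * v (-x) - v' (-x) * -v' (-x)) / v (-x) ^ 2) / 2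
        = -((Q x + Q (-x)) / 2) - ((v' x / v x) ^ 2 + (v' (-x) / v (-x)) ^ 2) / 2 := by
      field_simp
      ring
    rw [e]
    simp only [hR]
    generalize v' x / v x = r
    generalize v' (-x) / v (-x) = s
    nlinarith [sq_nonneg (u' x - u x * ((r - s) / 2)), sq_nonneg (u x * (r + s)),
      mul_nonneg (sq_nonneg (u x)) (sub_nonneg.2 (hqQ x hx))]
  have hΦnonneg : ∀ x ∈ Set.Icc 0 a, 0 ≤ Φ x := fun x hx => by
    have h := hΦmono (Set.left_mem_Icc.2 ha.le) hx hx.1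
    simpa [hΦ, hR, hu'0] using h
  have hfd : ∀ x ∈ Set.Icc 0 a, HasDerivAt (fun x => u x ^ 2 / (v x * v (-x)))
      (2 * Φ x / (v x * v (-x))) x := fun x hx => by
    obtain ⟨h1, h2⟩ := hpos x hx
    refine (((hu x).pow 2).div ((hv x).mul (hm x)) (mul_pos h1 h2).ne').congr_deriv ?_
    simp only [hΦ, hR, Pi.mul_apply, Pi.pow_apply]
    field_simp
    push_cast
    ring
  have hfmono : MonotoneOn (fun x => u x ^ 2 / (v x * v (-x))) (Set.Icc 0 a) :=
    monotoneOn_of_hasDerivWithinAt_nonneg (convex_Icc _ _)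
      (fun x hx => (hfd x hx).continuousAt.continuousWithinAt)
      (fun x hx => (hfd x (interior_subset hx)).hasDerivWithinAt)
      (fun x hx => by
        obtain ⟨h1, h2⟩ := hpos x (interior_subset hx)
        exact div_nonneg (mul_nonneg zero_le_two (hΦnonneg x (interior_subset hx)))
          (mul_pos h1 h2).le)
  have h := hfmono (Set.left_mem_Icc.2 ha.le) (Set.right_mem_Icc.2 ha.le) ha.le
  obtain ⟨h1, h2⟩ := hpos 0 ⟨le_rfl, ha.le⟩
  simp only [hua] at h
  have : 0 < u 0 ^ 2 / (v 0 * v (-0)) := by positivity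
  norm_num at h this
  linarith

section Legendre

open Polynomial

theorem iterate_derivative_X_sq_sub_one_pow (N n : ℕ) :
    (X ^ 2 - 1 : ℝ[X]) * derivative^[n + 2] ((X ^ 2 - 1) ^ N)
      + C (2 * ((n : ℝ) + 1 - N)) * X * derivative^[n + 1] ((X ^ 2 - 1) ^ N)
      + C (((n : ℝ) + 1) * n - 2 * N * (n + 1)) * derivative^[n] ((X ^ 2 - 1) ^ N) = 0 := by
  have hbase : (X ^ 2 - 1 : ℝ[X]) * derivative ((X ^ 2 - 1) ^ N)
      = C (2 * (N : ℝ)) * X * (X ^ 2 - 1) ^ N := by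
    cases N with
    | zero => simp
    | succ m =>
      simp only [derivative_pow, derivative_sub, derivative_X, derivative_one, map_mul,
        Nat.add_sub_cancel, map_natCast, map_ofNat]
      push_cast
      ring
  induction n with
  | zero =>
    have h := congrArg derivative hbase
    simp only [derivative_mul, derivative_C, derivative_sub, derivative_pow, derivative_X,
      derivative_one] at h
    simp only [Function.iterate_succ_apply', Function.iterate_zero_apply]
    simp only [derivative_mul, derivative_C, derivative_sub, derivative_pow, derivative_X,
      derivative_one]
    simp only [map_mul, map_sub, map_add, map_natCast, map_ofNat, map_one, map_zero] at h ⊢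
    push_cast at h ⊢
    linear_combination h
  | succ n ih =>
    have h := congrArg derivative ih
    simp only [derivative_mul, derivative_add, derivative_C, derivative_sub, derivative_pow,
      derivative_X, derivative_one, derivative_zero, ← Function.iterate_succ_apply'] at h
    simp only [map_mul, map_sub, map_add, map_natCast, map_ofNat, map_one] at h ⊢
    push_cast at h ⊢
    linear_combination h

theorem derivative_lglPoly (N : ℕ) :
    derivative (lglPoly N) = C (-((N : ℝ) * (N + 1))) * legendrePoly N := by
  have h := iterate_derivative_X_sq_sub_one_pow N N
  simp only [lglPoly, legendrePoly, derivative_mul, derivative_C, derivative_sub, derivative_pow,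
    derivative_X, derivative_one, ← Function.iterate_succ_apply', map_neg, zero_mul, zero_add]
  generalize (C (1 / (2 ^ N * N.factorial : ℝ)) : ℝ[X]) = c
  simp only [map_mul, map_sub, map_add, map_natCast, map_ofNat, map_one] at h ⊢
  push_cast at h ⊢
  linear_combination (-c) * h

/-- The polynomial `u = (1 - x²) L_N'` solves `(1 - x²) u'' + N (N + 1) u = 0`. -/
theorem eval_lglPoly_ode (N : ℕ) (x : ℝ) :
    (1 - x ^ 2) * (derivative (derivative (lglPoly N))).eval x
      = -((N : ℝ) * (N + 1)) * (lglPoly N).eval x := by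
  rw [derivative_lglPoly, derivative_mul]
  simp only [lglPoly, derivative_C, eval_add, eval_mul, eval_C, eval_sub, eval_pow, eval_X,
    eval_one, eval_zero]
  ring

theorem comp_neg_X_iterate_derivative (p : ℝ[X]) (n : ℕ) :
    (derivative^[n] p).comp (-X) = (-1) ^ n * derivative^[n] (p.comp (-X)) := by
  induction n generalizing p with
  | zero => simp
  | succ n ih =>
    rw [Function.iterate_succ_apply, ih, Function.iterate_succ_apply, derivative_comp]
    simp only [derivative_neg, derivative_X, neg_mul, one_mul, iterate_derivative_neg]
    ring

theorem legendrePoly_comp_neg_X (N : ℕ) :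
    (legendrePoly N).comp (-X) = (-1) ^ N * legendrePoly N := by
  rw [legendrePoly, mul_comp, comp_neg_X_iterate_derivative]
  simp only [pow_comp, sub_comp, X_comp, one_comp, C_comp, neg_sq]
  ring

theorem lglPoly_comp_neg_X (N : ℕ) :
    (lglPoly N).comp (-X) = (-1) ^ (N + 1) * lglPoly N := by
  have h := comp_neg_X_iterate_derivative (legendrePoly N) 1
  have hd : derivative ((-1 : ℝ[X]) ^ N * legendrePoly N)
      = (-1) ^ N * derivative (legendrePoly N) := by
    rcases neg_one_pow_eq_or ℝ[X] N with e | e <;> simp [e]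
  simp only [Function.iterate_one, legendrePoly_comp_neg_X, hd] at h
  simp only [lglPoly, mul_comp, sub_comp, one_comp, pow_comp, X_comp, h, neg_sq]
  ring

theorem eval_lglPoly_neg (N : ℕ) (x : ℝ) :
    (lglPoly N).eval (-x) = (-1) ^ (N + 1) * (lglPoly N).eval x := by
  simpa using congrArg (eval x) (lglPoly_comp_neg_X N)

theorem eval_derivative_lglPoly_zero {N : ℕ} (hN : Odd N) :
    (derivative (lglPoly N)).eval 0 = 0 := by
  have h := congrArg (eval 0) (legendrePoly_comp_neg_X N)
  simp only [eval_comp, eval_neg, eval_X, neg_zero, hN.neg_one_pow, neg_mul, one_mul] at h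
  rw [derivative_lglPoly, eval_mul, show (legendrePoly N).eval 0 = 0 by linarith, mul_zero]

end Legendre

namespace IsLGLNodes

variable {N : ℕ} {ξ : ℕ → ℝ}

theorem neg_one_le (h : IsLGLNodes N ξ) {k : ℕ} (hk : k ≤ N) : -1 ≤ ξ k :=
  h.2.1 ▸ h.1.monotoneOn (Set.mem_Iic.2 (Nat.zero_le N)) hk (Nat.zero_le k)

theorem le_one (h : IsLGLNodes N ξ) {k : ℕ} (hk : k ≤ N) : ξ k ≤ 1 :=
  h.2.2.1 ▸ h.1.monotoneOn hk Set.self_mem_Iic hk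

theorem symm (h : IsLGLNodes N ξ) {k : ℕ} (hk : k ≤ N) : ξ (N - k) = -ξ k := by
  obtain ⟨hmono, -, -, hzero, hall⟩ := h
  have hf : StrictMono fun i : Fin (N + 1) => ξ i := fun i j hij =>
    hmono (Nat.lt_succ_iff.1 i.2) (Nat.lt_succ_iff.1 j.2) hij
  have hg : StrictMono fun i : Fin (N + 1) => -ξ (N - i) := fun i j hij => by
    have hj := j.2
    have hij' : (i : ℕ) < j := hij
    exact neg_lt_neg (hmono (Set.mem_Iic.2 (Nat.sub_le ..)) (Set.mem_Iic.2 (Nat.sub_le ..))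
      (by omega))
  have hneg : ∀ x, (lglPoly N).eval x = 0 → (lglPoly N).eval (-x) = 0 := fun x hx => by
    rw [eval_lglPoly_neg, hx, mul_zero]
  have hrange : Set.range (fun i : Fin (N + 1) => ξ i)
      = Set.range fun i : Fin (N + 1) => -ξ (N - i) := by
    ext x
    constructor
    · rintro ⟨i, rfl⟩
      obtain ⟨m, hm, e⟩ := hall _ (hneg _ (hzero i (Nat.lt_succ_iff.1 i.2)))
      refine ⟨⟨N - m, by omega⟩, ?_⟩
      simp [Nat.sub_sub_self hm, e]
    · rintro ⟨i, rfl⟩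
      obtain ⟨m, hm, e⟩ := hall _ (hneg _ (hzero (N - i) (Nat.sub_le ..)))
      exact ⟨⟨m, by omega⟩, e⟩
  have := congrFun ((StrictMono.range_inj hf hg).1 hrange) ⟨k, by omega⟩
  simp only at this
  linarith

theorem eval_ne_zero (h : IsLGLNodes N ξ) {k : ℕ} (hk : k + 1 ≤ N) {x : ℝ}
    (hx : x ∈ Set.Ioo (ξ k) (ξ (k + 1))) : (lglPoly N).eval x ≠ 0 := by
  intro h0
  obtain ⟨m, hm, rfl⟩ := h.2.2.2.2 x h0
  have h1 := (h.1.lt_iff_lt (Set.mem_Iic.2 (by omega)) (Set.mem_Iic.2 hm)).1 hx.1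
  have h2 := (h.1.lt_iff_lt (Set.mem_Iic.2 hm) (Set.mem_Iic.2 hk)).1 hx.2
  omega

theorem exists_mul_eval_pos (h : IsLGLNodes N ξ) {k : ℕ} (hk : k + 1 ≤ N) :
    ∃ ε : ℝ, ∀ x ∈ Set.Ioo (ξ k) (ξ (k + 1)), 0 < ε * (lglPoly N).eval x := by
  obtain ⟨c, hc⟩ := exists_between (h.1 (Set.mem_Iic.2 (by omega)) (Set.mem_Iic.2 hk)
    (Nat.lt_succ_self k))
  refine ⟨(lglPoly N).eval c, fun x hx => ?_⟩
  by_contra! hneg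
  have hcont : ContinuousOn (fun x => (lglPoly N).eval c * (lglPoly N).eval x)
      (Set.Ioo (ξ k) (ξ (k + 1))) := by fun_prop
  obtain ⟨z, hz, e⟩ := isPreconnected_Ioo.intermediate_value hx hc hcont
    ⟨hneg, mul_self_nonneg _⟩
  rcases mul_eq_zero.1 e with e | e
  · exact h.eval_ne_zero hk hc e
  · exact h.eval_ne_zero hk hz e

theorem central_interval_maximal {M : ℕ} {η : ℕ → ℝ} {k j : ℕ} (hN : N = 2 * k + 1)
    (hNM : N ≤ M) (hξ : IsLGLNodes N ξ) (hη : IsLGLNodes M η) (hj : j + 1 ≤ M) :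
    η (j + 1) - η j ≤ ξ (k + 1) - ξ k := by
  by_contra! hlt
  have hsymm : ξ (k + 1) = -ξ k := by
    have := hξ.symm (k := k) (by omega)
    rwa [show N - k = k + 1 by omega] at this
  have hkk : ξ k < ξ (k + 1) :=
    hξ.1 (Set.mem_Iic.2 (by omega)) (Set.mem_Iic.2 (by omega)) (Nat.lt_succ_self k)
  have hξ1 := hξ.le_one (k := k + 1) (by omega)
  have hη0 := hη.neg_one_le (k := j) (by omega)
  have hη1 := hη.le_one hj
  obtain ⟨ε, hε⟩ := hη.exists_mul_eval_pos hj
  set a := ξ (k + 1) with ha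
  set t := (η j + η (j + 1)) / 2 with ht
  have hmem : ∀ x ∈ Set.Icc (-a) a, x + t ∈ Set.Ioo (η j) (η (j + 1)) := fun x hx =>
    ⟨by linarith [hx.1], by linarith [hx.2]⟩
  have hden : ∀ x ∈ Set.Icc (-a) a, 0 < 1 - (x + t) ^ 2 := fun x hx => by
    nlinarith [(hmem x hx).1, (hmem x hx).2]
  have hv : ∀ (p : Polynomial ℝ) (x : ℝ), HasDerivAt (fun x => ε * p.eval (x + t))
      (ε * p.derivative.eval (x + t)) x := fun p x => by
    simpa using ((p.hasDerivAt (x + t)).comp x ((hasDerivAt_id x).add_const t)).const_mul ε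
  refine symmetric_picone_comparison (a := a) (q := fun x => (N * (N + 1) : ℝ) / (1 - x ^ 2))
    (Q := fun x => (M * (M + 1) : ℝ) / (1 - (x + t) ^ 2)) (by linarith)
    (lglPoly N).hasDerivAt (lglPoly N).derivative.hasDerivAt (hv _) (hv _)
    (hξ.eval_ne_zero (k := k) (by omega) ⟨by linarith, by linarith⟩)
    (eval_derivative_lglPoly_zero ⟨k, hN⟩) (hξ.2.2.2.1 _ (by omega))
    (fun x hx => hε _ (hmem x hx)) (fun x hx => ?_) (fun x hx => ?_) (fun x hx => ?_)
  · have hd : 0 < 1 - x ^ 2 := by nlinarith [hx.1, hx.2]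
    have := eval_lglPoly_ode N x
    field_simp
    linarith
  · have hd := hden x ⟨hx.1.le, hx.2.le⟩
    have := eval_lglPoly_ode M (x + t)
    field_simp
    linear_combination ε * this
  · have hA := hden x ⟨by linarith [hx.1], hx.2.le⟩
    have hB := hden (-x) ⟨by linarith [hx.2], by linarith [hx.1, hx.2]⟩
    have hd : 0 < 1 - x ^ 2 := by nlinarith [hx.1, hx.2]
    have hcast : (N : ℝ) ≤ M := by exact_mod_cast hNM
    have hl : (N * (N + 1) : ℝ) ≤ M * (M + 1) := by gcongr
    have hconv : 2 / (1 - x ^ 2) ≤ 1 / (1 - (x + t) ^ 2) + 1 / (1 - (-x + t) ^ 2) := by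
      have hAB : 1 / (1 - (x + t) ^ 2) + 1 / (1 - (-x + t) ^ 2)
          = ((1 - (x + t) ^ 2) + (1 - (-x + t) ^ 2))
            / ((1 - (x + t) ^ 2) * (1 - (-x + t) ^ 2)) := by
        field_simp
        ring
      rw [hAB, div_le_div_iff₀ hd (mul_pos hA hB)]
      generalize hAe : 1 - (x + t) ^ 2 = A at *
      generalize hBe : 1 - (-x + t) ^ 2 = B at *
      have : 1 - x ^ 2 = (A + B) / 2 + t ^ 2 := by rw [← hAe, ← hBe]; ring
      rw [this]
      nlinarith [sq_nonneg (A - B), mul_nonneg (add_pos hA hB).le (sq_nonneg t)]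
    calc 2 * ((N * (N + 1) : ℝ) / (1 - x ^ 2)) = (N * (N + 1) : ℝ) * (2 / (1 - x ^ 2)) := by ring
      _ ≤ (M * (M + 1) : ℝ) * (1 / (1 - (x + t) ^ 2) + 1 / (1 - (-x + t) ^ 2)) := by gcongr
      _ = _ := by ring

theorem interval_le_of_left_half {M : ℕ} {η : ℕ → ℝ} {k j : ℕ} (hk : 2 * (k + 1) ≤ N)
    (hNM : N ≤ M) (hξ : IsLGLNodes N ξ) (hη : IsLGLNodes M η) (hj : j + 1 ≤ M)
    (hle : η j ≤ ξ k) :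
    η (j + 1) - η j ≤ ξ (k + 1) - ξ k := by
  by_contra! hlt
  have hnonpos : ξ (k + 1) ≤ 0 := by
    have h1 := hξ.symm (k := k + 1) (by omega)
    have h2 := hξ.1.monotoneOn (Set.mem_Iic.2 (by omega : k + 1 ≤ N))
      (Set.mem_Iic.2 (Nat.sub_le N (k + 1))) (by omega)
    linarith
  have hkk : ξ k < ξ (k + 1) :=
    hξ.1 (Set.mem_Iic.2 (by omega)) (Set.mem_Iic.2 (by omega)) (Nat.lt_succ_self k)
  have hη0 := hη.neg_one_le (k := j) (by omega)
  obtain ⟨δ, hδ⟩ := hξ.exists_mul_eval_pos (k := k) (by omega)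
  obtain ⟨ε, hε⟩ := hη.exists_mul_eval_pos hj
  set t := η j - ξ k with ht
  have hmem : ∀ x ∈ Set.Ioc (ξ k) (ξ (k + 1)), x + t ∈ Set.Ioo (η j) (η (j + 1)) :=
    fun x hx => ⟨by linarith [hx.1], by linarith [hx.2]⟩
  have hu : ∀ (p : Polynomial ℝ) (x : ℝ), HasDerivAt (fun x => δ * p.eval x)
      (δ * p.derivative.eval x) x := fun p x => (p.hasDerivAt x).const_mul δ
  have hv : ∀ (p : Polynomial ℝ) (x : ℝ), HasDerivAt (fun x => ε * p.eval (x + t))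
      (ε * p.derivative.eval (x + t)) x := fun p x => by
    simpa using ((p.hasDerivAt (x + t)).comp x ((hasDerivAt_id x).add_const t)).const_mul ε
  refine sturm_comparison hkk (hu (lglPoly N)) (hu _) (hv (lglPoly M)) (hv _)
    (by simp [hξ.2.2.2.1 k (by omega)]) (by simp [ht, hη.2.2.2.1 j (by omega)])
    (by simp [hξ.2.2.2.1 (k + 1) (by omega)]) hδ (fun x hx => hε _ (hmem x hx)) (fun x hx => ?_)
  have hx' : x ∈ Set.Ioc (ξ k) (ξ (k + 1)) := ⟨hx.1, hx.2.le⟩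
  have hB : 0 < 1 - (x + t) ^ 2 := by nlinarith [(hmem x hx').1, hx.2]
  have hBA : 1 - (x + t) ^ 2 ≤ 1 - x ^ 2 := by nlinarith [hx.2]
  have hA := hB.trans_le hBA
  have hcast : (N : ℝ) ≤ M := by exact_mod_cast hNM
  have hl : (N * (N + 1) : ℝ) ≤ M * (M + 1) := by gcongr
  have hq : (N * (N + 1) : ℝ) / (1 - x ^ 2) ≤ M * (M + 1) / (1 - (x + t) ^ 2) := by gcongr
  have e1 : (lglPoly N).derivative.derivative.eval x
      = -(N * (N + 1) / (1 - x ^ 2)) * (lglPoly N).eval x := by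
    have := eval_lglPoly_ode N x
    field_simp
    linarith
  have e2 : (lglPoly M).derivative.derivative.eval (x + t)
      = -(M * (M + 1) / (1 - (x + t) ^ 2)) * (lglPoly M).eval (x + t) := by
    have := eval_lglPoly_ode M (x + t)
    field_simp
    linarith
  rw [e1, e2]
  have := mul_nonneg (mul_pos (hδ x hx) (hε _ (hmem x hx'))).le (sub_nonneg.2 hq)
  linarith

end IsLGLNodes

/-- Displacement of LGL intervals with increasing order: if `M ≥ N ≥ 2`,
`0 ≤ k ≤ ⌊(N-1)/2⌋`, `0 ≤ j ≤ ⌊(M-1)/2⌋` and `ξ_j^M ≤ ξ_k^N`, then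
`|Δ_j^M| ≤ |Δ_k^N|`. -/
theorem lgl_interval_displacement (N M : ℕ) (hN : 2 ≤ N) (hNM : N ≤ M)
    (ξN ξM : ℕ → ℝ) (hξN : IsLGLNodes N ξN) (hξM : IsLGLNodes M ξM)
    (k j : ℕ) (hk : k ≤ (N - 1) / 2) (hj : j ≤ (M - 1) / 2)
    (hle : ξM j ≤ ξN k) :
    ξM (j + 1) - ξM j ≤ ξN (k + 1) - ξN k := by
  rcases Nat.lt_or_ge N (2 * (k + 1)) with h | h
  · exact IsLGLNodes.central_interval_maximal (by omega) hNM hξN hξM (by omega)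
  · exact IsLGLNodes.interval_le_of_left_half h hNM hξN hξM (by omega) hle
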